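/- Let F_a and F_b be real polynomials of total degree at most 3 in two variables and let p = (c,d) be a base point: F_a(c,d) = F_b(c,d) = 0. Let ι_p be the generalised Manin involution with degree parameter D = 3 and involution point p. Then at every point (u,v) at which the defining denominator −2G₁ − G₂ is nonzero and at which F_a(u,v) ≠ 0 and F_a(ι_p(u,v)) ≠ 0, the map ι_p is differentiable and the determinant of its total derivative equals −F_a(ι_p(u,v))/F_a(u,v); that is, ι_p is anti measure preserving with density 1/F_a. -/

import Mathlib

open MvPolynomial

/-- Evaluation of a bivariate polynomial at a point of the plane. -/
noncomputable def pev (F : MvPolynomial (Fin 2) ℝ) (w : ℝ × ℝ) : ℝ :=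
  eval ![w.1, w.2] F

/-- First directional quantity `F⁽¹⁾ = (c−u)Fᵤ + (d−v)Fᵥ` at `w = (u,v)`, direction point `p = (c,d)`. -/
noncomputable def d1 (F : MvPolynomial (Fin 2) ℝ) (p w : ℝ × ℝ) : ℝ :=
  (p.1 - w.1) * pev (pderiv (0 : Fin 2) F) w + (p.2 - w.2) * pev (pderiv (1 : Fin 2) F) w

/-- Second directional quantity `F⁽²⁾` at `w = (u,v)`, direction point `p = (c,d)`. -/
noncomputable def d2 (F : MvPolynomial (Fin 2) ℝ) (p w : ℝ × ℝ) : ℝ :=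
  (p.1 - w.1) ^ 2 * pev (pderiv (0 : Fin 2) (pderiv (0 : Fin 2) F)) w
    + 2 * (p.1 - w.1) * (p.2 - w.2) * pev (pderiv (1 : Fin 2) (pderiv (0 : Fin 2) F)) w
    + (p.2 - w.2) ^ 2 * pev (pderiv (1 : Fin 2) (pderiv (1 : Fin 2) F)) w

/-- `G₁ = F_a·F_b⁽¹⁾ − F_a⁽¹⁾·F_b`. -/
noncomputable def G1 (Fa Fb : MvPolynomial (Fin 2) ℝ) (p w : ℝ × ℝ) : ℝ :=
  pev Fa w * d1 Fb p w - d1 Fa p w * pev Fb w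

/-- `G₂ = F_a·F_b⁽²⁾ − F_a⁽²⁾·F_b`. -/
noncomputable def G2 (Fa Fb : MvPolynomial (Fin 2) ℝ) (p w : ℝ × ℝ) : ℝ :=
  pev Fa w * d2 Fb p w - d2 Fa p w * pev Fb w

/-- The defining denominator `2(2−D)G₁ − G₂` of the generalised Manin involution. -/
noncomputable def den (Fa Fb : MvPolynomial (Fin 2) ℝ) (D : ℕ) (p w : ℝ × ℝ) : ℝ :=
  2 * (2 - (D : ℝ)) * G1 Fa Fb p w - G2 Fa Fb p w

/-- The generalised Manin involution `ι_p(u,v) = (u,v) + z·(p − (u,v))`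
with `z = 2G₁ / (2(2−D)G₁ − G₂)`. -/
noncomputable def manin (Fa Fb : MvPolynomial (Fin 2) ℝ) (D : ℕ) (p w : ℝ × ℝ) : ℝ × ℝ :=
  w + (2 * G1 Fa Fb p w / den Fa Fb D p w) • (p - w)

/-- Evaluation at a point of the plane is a differentiable function. -/
lemma differentiable_pev (F : MvPolynomial (Fin 2) ℝ) : Differentiable ℝ (pev F) := by
  unfold pev
  induction F using MvPolynomial.induction_on with
  | C a => simp
  | add f g hf hg => simpa using hf.fun_add hg
  | mul_X f i hf =>
    fin_cases i
    · simpa using hf.fun_mul differentiable_fst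
    · simpa using hf.fun_mul differentiable_snd

lemma differentiable_G1 (Fa Fb : MvPolynomial (Fin 2) ℝ) (p : ℝ × ℝ) :
    Differentiable ℝ (G1 Fa Fb p) := by
  have h := differentiable_pev
  unfold G1 d1
  fun_prop

lemma differentiable_den (Fa Fb : MvPolynomial (Fin 2) ℝ) (D : ℕ) (p : ℝ × ℝ) :
    Differentiable ℝ (den Fa Fb D p) := by
  have h := differentiable_pev
  have h1 := differentiable_G1
  unfold den G2 d2
  fun_prop

/-- The chain rule for substituting univariate polynomials into a bivariate one. -/
lemma derivative_aeval_eq_sum_pderiv {R : Type*} [CommSemiring R]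
    (g : Fin 2 → Polynomial R) (F : MvPolynomial (Fin 2) R) :
    (aeval g F).derivative =
      ∑ i, aeval g (pderiv i F) * (g i).derivative := by
  induction F using MvPolynomial.induction_on with
  | C a => simp
  | add f h hf hh =>
    simp only [map_add, hf, hh, add_mul, Finset.sum_add_distrib]
  | mul_X f i hf =>
    fin_cases i <;> simp [hf, Fin.sum_univ_two, pderiv_X] <;> ring

/-- The restriction of `F` to the line through `p` and `w`, as a univariate polynomial. -/
noncomputable def linePoly (F : MvPolynomial (Fin 2) ℝ) (p w : ℝ × ℝ) : Polynomial ℝ :=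
  aeval ![Polynomial.C (w.1 - p.1) * Polynomial.X + Polynomial.C p.1,
    Polynomial.C (w.2 - p.2) * Polynomial.X + Polynomial.C p.2] F

lemma natDegree_linePoly_le {F : MvPolynomial (Fin 2) ℝ} {n : ℕ} (hF : F.totalDegree ≤ n)
    (p w : ℝ × ℝ) : (linePoly F p w).natDegree ≤ n := by
  refine (aeval_natDegree_le (n := 1) F hF _ fun i => ?_).trans_eq (mul_one n)
  fin_cases i <;> exact Polynomial.natDegree_linear_le

lemma eval_linePoly (F : MvPolynomial (Fin 2) ℝ) (p w : ℝ × ℝ) (s : ℝ) :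
    (linePoly F p w).eval s = pev F (p + s • (w - p)) := by
  rw [linePoly, pev, aeval_def, Polynomial.algebraMap_eq, ← Polynomial.coe_evalRingHom,
    ← coe_eval₂Hom, ← RingHom.comp_apply]
  refine RingHom.congr_fun (ringHom_ext (fun r => by simp) fun i => ?_) F
  fin_cases i <;> simp <;> ring

lemma derivative_linePoly (F : MvPolynomial (Fin 2) ℝ) (p w : ℝ × ℝ) :
    (linePoly F p w).derivative =
      linePoly (pderiv 0 F) p w * Polynomial.C (w.1 - p.1) +
        linePoly (pderiv 1 F) p w * Polynomial.C (w.2 - p.2) := by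
  rw [linePoly, derivative_aeval_eq_sum_pderiv, Fin.sum_univ_two]
  simp [linePoly]

lemma pderiv_comm_fin_two (F : MvPolynomial (Fin 2) ℝ) :
    pderiv 0 (pderiv 1 F) = pderiv 1 (pderiv 0 F) := by
  induction F using MvPolynomial.induction_on with
  | C a => simp
  | add f h hf hh => simp [hf, hh]
  | mul_X f i hf => fin_cases i <;> simp [hf, pderiv_X, add_comm]

lemma d1_eq_eval_derivative (F : MvPolynomial (Fin 2) ℝ) (p w : ℝ × ℝ) (s : ℝ) :
    d1 F p (p + s • (w - p)) = -(s * (linePoly F p w).derivative.eval s) := by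
  simp [d1, derivative_linePoly, eval_linePoly]
  ring

lemma d2_eq_eval_derivative (F : MvPolynomial (Fin 2) ℝ) (p w : ℝ × ℝ) (s : ℝ) :
    d2 F p (p + s • (w - p)) = s ^ 2 * (linePoly F p w).derivative.derivative.eval s := by
  simp [d2, derivative_linePoly, eval_linePoly, pderiv_comm_fin_two]
  ring

/-- Along a line through a base point, a cubic and its two directional quantities are
determined by three coefficients. -/
lemma exists_cubic_coeffs_along_line {F : MvPolynomial (Fin 2) ℝ} (hF : F.totalDegree ≤ 3)
    {p : ℝ × ℝ} (hp : pev F p = 0) (w : ℝ × ℝ) :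
    ∃ a₁ a₂ a₃ : ℝ, ∀ s : ℝ,
      pev F (p + s • (w - p)) = a₁ * s + a₂ * s ^ 2 + a₃ * s ^ 3 ∧
      d1 F p (p + s • (w - p)) = -(a₁ * s + 2 * a₂ * s ^ 2 + 3 * a₃ * s ^ 3) ∧
      d2 F p (p + s • (w - p)) = 2 * a₂ * s ^ 2 + 6 * a₃ * s ^ 3 := by
  have hq := (linePoly F p w).as_sum_range_C_mul_X_pow'
    (Nat.lt_succ_of_le (natDegree_linePoly_le hF p w))
  have h0 : (linePoly F p w).coeff 0 = 0 := by
    simpa [Polynomial.coeff_zero_eq_eval_zero, eval_linePoly] using hp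
  simp only [Finset.sum_range_succ, Finset.sum_range_zero, h0] at hq
  refine ⟨(linePoly F p w).coeff 1, (linePoly F p w).coeff 2, (linePoly F p w).coeff 3,
    fun s => ?_⟩
  rw [← eval_linePoly, d1_eq_eval_derivative, d2_eq_eval_derivative]
  generalize (linePoly F p w).coeff 1 = a₁ at hq ⊢
  generalize (linePoly F p w).coeff 2 = a₂ at hq ⊢
  generalize (linePoly F p w).coeff 3 = a₃ at hq ⊢
  rw [hq]
  refine ⟨?_, ?_, ?_⟩ <;> simp <;> ring

/-- The determinant of a multiple of the identity plus a rank-one map of the plane. -/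
lemma det_smul_id_add_smulRight (c : ℝ) (f : ℝ × ℝ →L[ℝ] ℝ) (v : ℝ × ℝ) :
    (c • ContinuousLinearMap.id ℝ (ℝ × ℝ) + f.smulRight v).det = c ^ 2 + c * f v := by
  have hv : f v = v.1 * f (1, 0) + v.2 * f (0, 1) := by
    rw [← smul_eq_mul, ← smul_eq_mul, ← map_smul, ← map_smul, ← map_add]
    simp
  rw [ContinuousLinearMap.det, ← LinearMap.det_toMatrix (Module.Basis.finTwoProd ℝ),
    Matrix.det_fin_two, hv]
  simp [LinearMap.toMatrix_apply]
  ring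

/-- for a cubic pencil with base point `p`, the generalised Manin
involution `ι_p` (with `D = 3`) is anti measure preserving with density `1/F_a`:
wherever defined, `det (Dι_p) = −F_a(ι_p(w))/F_a(w)`. -/
theorem manin_involution_anti_measure_preserving_cubic
    (Fa Fb : MvPolynomial (Fin 2) ℝ)
    (hFa : Fa.totalDegree ≤ 3) (hFb : Fb.totalDegree ≤ 3)
    (p : ℝ × ℝ) (hpa : pev Fa p = 0) (hpb : pev Fb p = 0)
    (w : ℝ × ℝ)
    (hden : den Fa Fb 3 p w ≠ 0)
    (hρ : pev Fa w ≠ 0)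
    (hρ' : pev Fa (manin Fa Fb 3 p w) ≠ 0) :
    DifferentiableAt ℝ (manin Fa Fb 3 p) w ∧
      (fderiv ℝ (manin Fa Fb 3 p) w).det =
        -(pev Fa (manin Fa Fb 3 p w) / pev Fa w) := by
  set z : ℝ × ℝ → ℝ := fun x => 2 * G1 Fa Fb p x / den Fa Fb 3 p x with hz
  have hzd : DifferentiableAt ℝ z w :=
    ((differentiable_G1 Fa Fb p w).const_mul 2).mul ((differentiable_den Fa Fb 3 p w).fun_inv hden)
  have hm : HasFDerivAt (manin Fa Fb 3 p)
      ((1 - z w) • ContinuousLinearMap.id ℝ (ℝ × ℝ) + (fderiv ℝ z w).smulRight (p - w)) w := by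
    refine ((hasFDerivAt_id w).add
      (hzd.hasFDerivAt.smul ((hasFDerivAt_id w).const_sub p))).congr_fderiv ?_
    ext <;> simp <;> ring
  refine ⟨hm.differentiableAt, ?_⟩
  rw [hm.fderiv, det_smul_id_add_smulRight]
  obtain ⟨a₁, a₂, a₃, ha⟩ := exists_cubic_coeffs_along_line hFa hpa w
  obtain ⟨b₁, b₂, b₃, hb⟩ := exists_cubic_coeffs_along_line hFb hpb w
  -- The Plücker-type minors of the coefficients of the two restricted cubics.
  set α := a₁ * b₂ - a₂ * b₁ with hα
  set β := a₁ * b₃ - a₃ * b₁ with hβ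
  set γ := a₂ * b₃ - a₃ * b₂ with hγ
  have hG1 (s : ℝ) : G1 Fa Fb p (p + s • (w - p)) = -(α * s ^ 3 + 2 * β * s ^ 4 + γ * s ^ 5) := by
    simp only [G1, ha, hb, hα, hβ, hγ]
    ring
  have hD (s : ℝ) : den Fa Fb 3 p (p + s • (w - p)) = -(2 * (β * s ^ 4 + γ * s ^ 5)) := by
    simp only [den, hG1, G2, ha, hb, hα, hβ, hγ]
    push_cast
    ring
  have hline (s : ℝ) : z (p + s • (w - p)) =
      2 * -(α * s ^ 3 + 2 * β * s ^ 4 + γ * s ^ 5) / -(2 * (β * s ^ 4 + γ * s ^ 5)) := by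
    rw [hz]
    simp only [hG1, hD]
  have hw : p + (1 : ℝ) • (w - p) = w := by simp
  have hβγ : β + γ ≠ 0 := by
    intro h
    apply hden
    rw [← hw, hD]
    linear_combination -2 * h
  have hzw : z w = (α + 2 * β + γ) / (β + γ) := by
    rw [← hw, hline]
    field_simp
  have hdir : fderiv ℝ z w (w - p) =
      ((3 * α + 8 * β + 5 * γ) * (β + γ) - (α + 2 * β + γ) * (4 * β + 5 * γ)) / (β + γ) ^ 2 := by
    have hpath : HasDerivAt (fun s : ℝ => p + s • (w - p)) (w - p) 1 := by
      simpa using ((hasDerivAt_id (1 : ℝ)).smul_const (w - p)).const_add p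
    have hcomp : HasDerivAt (fun s : ℝ => z (p + s • (w - p))) (fderiv ℝ z w (w - p)) 1 :=
      HasFDerivAt.comp_hasDerivAt_of_eq 1 hzd.hasFDerivAt hpath hw.symm
    simp only [hline] at hcomp
    have hpow (n : ℕ) (c : ℝ) : HasDerivAt (fun s : ℝ => c * s ^ n) (c * n) 1 := by
      simpa using (hasDerivAt_pow n (1 : ℝ)).const_mul c
    have hquot := ((((hpow 3 α).add (hpow 4 (2 * β))).add (hpow 5 γ)).neg.const_mul 2).div
      (((hpow 4 β).add (hpow 5 γ)).const_mul 2).neg (by simpa using hβγ)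
    rw [hcomp.unique hquot]
    simp
    field_simp
    ring
  have hpa' : pev Fa w = a₁ + a₂ + a₃ := by simpa [hw] using (ha 1).1
  have hmw : manin Fa Fb 3 p w = p + (1 - z w) • (w - p) := by
    rw [manin]
    ext <;> simp [hz] <;> ring
  have hdir' : fderiv ℝ z w (p - w) = -fderiv ℝ z w (w - p) := by
    rw [← map_neg, neg_sub]
  rw [hdir', hdir, hmw, (ha _).1, hpa', hzw]
  rw [hpa'] at hρ
  have hplucker : a₁ * γ - a₂ * β + a₃ * α = 0 := by
    simp only [hα, hβ, hγ]
    ring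
  clear_value α β γ
  have hkey : (β ^ 2 - α * γ) * (a₁ + a₂ + a₃) =
      (β + γ) ^ 2 * a₁ - (α + β) * (β + γ) * a₂ + (α + β) ^ 2 * a₃ := by
    linear_combination -(α + 2 * β + γ) * hplucker
  field_simp
  linear_combination (α + β) * hkey
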